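/- Let m, n, k be non-negative integers with 1 ≤ k ≤ n, and let 1 ≤ b_1 < b_2 < … < b_k ≤ m+k be integers. Then the number of (m,n,k)-Gog trapezoids with bottom row (b_1,…,b_k) equals the constant term in x_1,…,x_n of the Laurent polynomial ∏_{i=1}^{k} (1+x_i)^{b_i} x_i^{−n+1} · ∏_{i=k+1}^{n} (1+x_i)^{m+k+1} x_i^{−n+i−k} · ∏_{1≤i<j≤n} (x_i − x_j)(1 + x_j + x_i x_j). -/

import Mathlib

open scoped BigOperators

/-- The position `(i,j)` (row `i`, `j`-th entry of the row, both 1-based) belongs to the shape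
of an `(m,n,k)`-Gog trapezoid. -/
def GogPos (n k i j : ℕ) : Prop := 1 ≤ i ∧ i ≤ n ∧ 1 ≤ j ∧ j ≤ i ∧ j ≤ k

/-- An `(m,n,k)`-Gog trapezoid, encoded as `a : ℕ → ℕ → ℤ` (zero off the shape): positive
entries, weak increase along NE- and SE-diagonals, strict increase along rows, and the entries
of the `i`-th SE-diagonal bounded above by `m+i`, i.e. `a i j ≤ m + n − i + j`. -/
def IsGog (m n k : ℕ) (a : ℕ → ℕ → ℤ) : Prop :=
  (∀ i j, GogPos n k i j → 1 ≤ a i j ∧ a i j ≤ ((m + (n - i) + j : ℕ) : ℤ)) ∧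
  (∀ i j, GogPos n k i j → GogPos n k (i+1) j → a (i+1) j ≤ a i j) ∧
  (∀ i j, GogPos n k i j → GogPos n k (i+1) (j+1) → a i j ≤ a (i+1) (j+1)) ∧
  (∀ i j, GogPos n k i j → GogPos n k i (j+1) → a i j < a i (j+1)) ∧
  (∀ i j, ¬ GogPos n k i j → a i j = 0)

/-- The exponent vector with `x_i`-entry `n−1` for `1 ≤ i ≤ k` and `n+k−i` for `k < i ≤ n`:
taking this coefficient amounts to taking the constant term after multiplying by
`∏_{i=1}^{k} x_i^{−n+1} ∏_{i=k+1}^{n} x_i^{−n+i−k}`. -/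
noncomputable def gogDeg (n k : ℕ) : ℕ →₀ ℕ :=
  (∑ i ∈ Finset.Icc 1 k, Finsupp.single i (n-1)) +
    ∑ i ∈ Finset.Icc (k+1) n, Finsupp.single i (n + k - i)

open Classical in
/-- The finite set of sequences `l` supported on `{0, …, s-1}` that are strictly increasing there
and interlace with `b`, i.e. `b i ≤ l i ≤ b (i+1)`. -/
noncomputable def interlacing (b : ℕ → ℕ) : ℕ → Finset (ℕ → ℕ)
  | 0 => {0}
  | s + 1 => ((interlacing b s ×ˢ Finset.Icc (b s) (b (s + 1))).filter
      (fun p => s = 0 ∨ p.1 (s - 1) < p.2)).image (fun p => Function.update p.1 s p.2)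

theorem mem_interlacing {b : ℕ → ℕ} {s : ℕ} {l : ℕ → ℕ} :
    l ∈ interlacing b s ↔ (∀ i < s, b i ≤ l i ∧ l i ≤ b (i + 1)) ∧
      (∀ i, i + 1 < s → l i < l (i + 1)) ∧ ∀ i, s ≤ i → l i = 0 := by
  induction s generalizing l with
  | zero =>
    simp only [interlacing, Finset.mem_singleton, funext_iff]
    simp
  | succ s ih =>
    simp only [interlacing, Finset.mem_image, Finset.mem_filter, Finset.mem_product, ih,
      Finset.mem_Icc, Prod.exists]
    constructor
    · rintro ⟨p, t, ⟨⟨⟨h1, h2, h3⟩, h4⟩, h5⟩, rfl⟩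
      refine ⟨fun i hi => ?_, fun i hi => ?_, fun i hi => ?_⟩
      · rcases eq_or_ne i s with rfl | h
        · simpa using h4
        · simpa [h] using h1 i (by omega)
      · rcases eq_or_ne (i + 1) s with rfl | h
        · simpa using h5
        · rw [Function.update_of_ne (by omega), Function.update_of_ne h]
          exact h2 i (by omega)
      · rw [Function.update_of_ne (by omega)]
        exact h3 i (by omega)
    · rintro ⟨h1, h2, h3⟩
      refine ⟨Function.update l s 0, l s,
        ⟨⟨⟨fun i hi => ?_, fun i hi => ?_, fun i hi => ?_⟩, h1 s (by omega)⟩, ?_⟩, by simp⟩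
      · rw [Function.update_of_ne (by omega)]
        exact h1 i (by omega)
      · rw [Function.update_of_ne (by omega), Function.update_of_ne (by omega)]
        exact h2 i (by omega)
      · rcases eq_or_ne i s with rfl | h
        · simp
        · rw [Function.update_of_ne h]
          exact h3 i (by omega)
      · rcases Nat.eq_zero_or_pos s with h | h
        · exact Or.inl h
        · right
          rw [Function.update_of_ne (by omega)]
          obtain ⟨t, rfl⟩ := Nat.exists_eq_add_of_le' h
          exact h2 t (by omega)

section Weights

variable {R : Type*} [CommRing R]

/-- The generating function of `interlacing b s`, each entry `t` in position `i` having weight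
`y_i ^ t * (y_i - 1)`. -/
noncomputable def interlacingSum (b : ℕ → ℕ) (y : ℕ → R) (s : ℕ) : R :=
  ∑ l ∈ interlacing b s, ∏ i ∈ Finset.range s, (y i ^ l i * (y i - 1))

/-- The alternating sum to which `interlacingSum` reduces under shift-antisymmetric functionals. -/
def boundarySum (b : ℕ → ℕ) (y : ℕ → R) (s : ℕ) : R :=
  ∑ r ∈ Finset.range (s + 1), (-1) ^ r * (∏ i ∈ Finset.range r, y i ^ b i) *
    ∏ i ∈ Finset.Ico r s, y i ^ (b (i + 1) + 1)

theorem boundarySum_zero (b : ℕ → ℕ) (y : ℕ → R) : boundarySum b y 0 = 1 := by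
  simp [boundarySum]

theorem boundarySum_succ (b : ℕ → ℕ) (y : ℕ → R) (s : ℕ) :
    boundarySum b y (s + 1) = boundarySum b y s * y s ^ (b (s + 1) + 1) +
      (-1) ^ (s + 1) * ∏ i ∈ Finset.range (s + 1), y i ^ b i := by
  rw [boundarySum, Finset.sum_range_succ, boundarySum, Finset.sum_mul]
  congr 1
  · refine Finset.sum_congr rfl fun r hr => ?_
    rw [Finset.prod_Ico_succ_top (by simpa [Nat.lt_succ_iff] using hr)]
    ring
  · simp

theorem sum_Icc_pow_mul (y : R) {a c : ℕ} (h : a ≤ c) :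
    ∑ t ∈ Finset.Icc a c, y ^ t * (y - 1) = y ^ (c + 1) - y ^ a := by
  induction c, h using Nat.le_induction with
  | base => simp; ring
  | succ c hc ih => rw [Finset.sum_Icc_succ_top (by omega), ih]; ring

theorem sum_interlacing_succ (b : ℕ → ℕ) (s : ℕ) (f : (ℕ → ℕ) → R) :
    ∑ l ∈ interlacing b (s + 1), f l =
      ∑ p ∈ (interlacing b s ×ˢ Finset.Icc (b s) (b (s + 1))).filter
        (fun p => s = 0 ∨ p.1 (s - 1) < p.2), f (Function.update p.1 s p.2) := by
  classical
  rw [interlacing, Finset.sum_image]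
  rintro ⟨p, t⟩ hp ⟨q, u⟩ hq h
  simp only [Finset.coe_filter, Finset.mem_product, Set.mem_ofPred_eq, mem_interlacing] at hp hq
  have ht : t = u := by simpa using congrFun h s
  refine Prod.ext (funext fun i => ?_) ht
  rcases eq_or_ne i s with rfl | hi
  · exact (hp.1.1.2.2 i le_rfl).trans (hq.1.1.2.2 i le_rfl).symm
  · simpa [hi] using congrFun h i

theorem prod_range_update (y : ℕ → R) (p : ℕ → ℕ) (s t : ℕ) :
    ∏ i ∈ Finset.range (s + 1), (y i ^ Function.update p s t i * (y i - 1)) =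
      (∏ i ∈ Finset.range s, (y i ^ p i * (y i - 1))) * (y s ^ t * (y s - 1)) := by
  rw [Finset.prod_range_succ, Function.update_self]
  congr 1
  refine Finset.prod_congr rfl fun i hi => ?_
  rw [Function.update_of_ne (Finset.mem_range.mp hi).ne]

theorem interlacingSum_zero (b : ℕ → ℕ) (y : ℕ → R) : interlacingSum b y 0 = 1 := by
  simp [interlacingSum, interlacing]

theorem interlacingSum_one (b : ℕ → ℕ) (y : ℕ → R) (h : b 0 ≤ b 1) :
    interlacingSum b y 1 = y 0 ^ (b 1 + 1) - y 0 ^ b 0 := by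
  rw [interlacingSum, sum_interlacing_succ, ← sum_Icc_pow_mul _ h]
  simp [interlacing]

theorem interlacingSum_add_two (b : ℕ → ℕ) (y : ℕ → R) (s : ℕ)
    (h : ∀ i ≤ s + 1, b i < b (i + 1)) :
    interlacingSum b y (s + 2) =
      interlacingSum b y (s + 1) * (y (s + 1) ^ (b (s + 2) + 1) - y (s + 1) ^ b (s + 1)) -
      interlacingSum b y s * ((y s * y (s + 1)) ^ b (s + 1) * ((y s - 1) * (y (s + 1) - 1))) := by
  classical
  have key : ∑ p ∈ (interlacing b (s + 1) ×ˢ Finset.Icc (b (s + 1)) (b (s + 2))).filter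
        (fun p => ¬ (s + 1 = 0 ∨ p.1 (s + 1 - 1) < p.2)),
        ∏ i ∈ Finset.range (s + 2), (y i ^ Function.update p.1 (s + 1) p.2 i * (y i - 1)) =
      interlacingSum b y s *
        ((y s * y (s + 1)) ^ b (s + 1) * ((y s - 1) * (y (s + 1) - 1))) := by
    rw [interlacingSum, Finset.sum_mul]
    symm
    refine Finset.sum_nbij' (fun q => (Function.update q s (b (s + 1)), b (s + 1)))
      (fun p => Function.update p.1 s 0) ?_ ?_ ?_ ?_ ?_
    · intro q hq
      rw [mem_interlacing] at hq
      obtain ⟨h1, h2, h3⟩ := hq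
      simp only [Finset.mem_filter, Finset.mem_product, mem_interlacing, Finset.mem_Icc]
      refine ⟨⟨⟨fun i hi => ?_, fun i hi => ?_, fun i hi => ?_⟩, le_rfl,
        (h (s + 1) le_rfl).le⟩, by simp⟩
      · rcases eq_or_ne i s with rfl | hne
        · simpa using (h i (by omega)).le
        · rw [Function.update_of_ne hne]; exact h1 i (by omega)
      · rw [Function.update_of_ne (by omega)]
        rcases eq_or_ne (i + 1) s with rfl | hne
        · simpa using (h1 i (by omega)).2.trans_lt (h (i + 1) (by omega))
        · rw [Function.update_of_ne hne]; exact h2 i (by omega)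
      · rw [Function.update_of_ne (by omega)]; exact h3 i (by omega)
    · rintro ⟨p, t⟩ hp
      simp only [Finset.mem_filter, Finset.mem_product, mem_interlacing, Finset.mem_Icc] at hp ⊢
      obtain ⟨⟨⟨h1, h2, h3⟩, -⟩, -⟩ := hp
      refine ⟨fun i hi => ?_, fun i hi => ?_, fun i hi => ?_⟩
      · rw [Function.update_of_ne (by omega)]; exact h1 i (by omega)
      · rw [Function.update_of_ne (by omega), Function.update_of_ne (by omega)]
        exact h2 i (by omega)
      · rcases eq_or_ne i s with rfl | hne
        · simp
        · rw [Function.update_of_ne hne]; exact h3 i (by omega)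
    · intro q hq
      rw [mem_interlacing] at hq
      simp [← hq.2.2 s le_rfl]
    · rintro ⟨p, t⟩ hp
      simp only [Finset.mem_filter, Finset.mem_product, mem_interlacing, Finset.mem_Icc] at hp
      obtain ⟨⟨⟨h1, -, -⟩, h4⟩, h5⟩ := hp
      have h6 := h1 s (by omega)
      simp only [Nat.add_sub_cancel] at h5
      have e1 : t = b (s + 1) := by omega
      have e2 : b (s + 1) = p s := by omega
      simp only [Function.update_idem]
      rw [e1, e2, Function.update_eq_self]
    · intro q hq
      rw [prod_range_update, prod_range_update]
      ring
  rw [interlacingSum, sum_interlacing_succ, ← key, eq_sub_iff_add_eq,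
    Finset.sum_filter_add_sum_filter_not, Finset.sum_product, interlacingSum, Finset.sum_mul]
  refine Finset.sum_congr rfl fun p hp => ?_
  rw [← sum_Icc_pow_mul _ (h (s + 1) le_rfl).le, Finset.mul_sum]
  exact Finset.sum_congr rfl fun t ht => prod_range_update _ _ _ _

/-- A functional killing every multiple of `1 - y_{i+1} + y_i y_{i+1}` by an element fixed by the
exchange `τ i` of `y_i` and `y_{i+1}` does not distinguish `interlacingSum` from `boundarySum`. -/
theorem map_interlacingSum_mul {A : Type*} [AddCommGroup A] (Λ : R →+ A) (b : ℕ → ℕ) (y : ℕ → R)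
    (τ : ℕ → R →+* R) (s : ℕ) (hb : ∀ i < s, b i < b (i + 1))
    (h_left : ∀ i, i + 1 < s → τ i (y i) = y (i + 1))
    (h_right : ∀ i, i + 1 < s → τ i (y (i + 1)) = y i)
    (h_fix : ∀ i, i + 1 < s → ∀ j < s, j ≠ i → j ≠ i + 1 → τ i (y j) = y j)
    (hΛ : ∀ i, i + 1 < s → ∀ f, τ i f = f → Λ (f * (1 - y (i + 1) + y i * y (i + 1))) = 0)
    (g : R) (hg : ∀ i, i + 1 < s → τ i g = g) :
    Λ (interlacingSum b y s * g) = Λ (boundarySum b y s * g) := by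
  induction s using Nat.twoStepInduction generalizing g with
  | zero => rw [interlacingSum_zero, boundarySum_zero]
  | one =>
    rw [interlacingSum_one _ _ (hb 0 (by omega)).le, boundarySum_succ, boundarySum_zero]
    congr 2
    simp
    ring
  | more s ih1 ih2 =>
    have i1 := ih2 (fun i hi => hb i (by omega)) (fun i hi => h_left i (by omega))
      (fun i hi => h_right i (by omega)) (fun i hi j hj => h_fix i (by omega) j (by omega))
      (fun i hi => hΛ i (by omega))
      ((y (s + 1) ^ (b (s + 2) + 1) - y (s + 1) ^ b (s + 1)) * g) (fun i hi => by
        simp only [map_mul, map_sub, map_pow]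
        rw [hg i (by omega), h_fix i (by omega) (s + 1) (by omega) (by omega) (by omega)])
    have i0 := ih1 (fun i hi => hb i (by omega)) (fun i hi => h_left i (by omega))
      (fun i hi => h_right i (by omega)) (fun i hi j hj => h_fix i (by omega) j (by omega))
      (fun i hi => hΛ i (by omega))
      ((y s * y (s + 1)) ^ b (s + 1) * ((y s - 1) * (y (s + 1) - 1)) * g) (fun i hi => by
        simp only [map_mul, map_sub, map_pow, map_one]
        rw [hg i (by omega), h_fix i (by omega) (s + 1) (by omega) (by omega) (by omega),
          h_fix i (by omega) s (by omega) (by omega) (by omega)])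
    have hT : τ s (boundarySum b y s) = boundarySum b y s := by
      simp only [boundarySum, map_sum, map_mul, map_prod, map_pow, map_neg, map_one]
      refine Finset.sum_congr rfl fun r hr => ?_
      rw [Finset.mem_range] at hr
      congr 1
      · congr 1
        refine Finset.prod_congr rfl fun i hi => ?_
        rw [Finset.mem_range] at hi
        rw [h_fix s (by omega) i (by omega) (by omega) (by omega)]
      · refine Finset.prod_congr rfl fun i hi => ?_
        rw [Finset.mem_Ico] at hi
        rw [h_fix s (by omega) i (by omega) (by omega) (by omega)]
    have i2 := hΛ s (by omega) (boundarySum b y s * (y s * y (s + 1)) ^ b (s + 1) * g) (by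
      simp only [map_mul, map_pow]
      rw [hT, hg s (by omega), h_left s (by omega), h_right s (by omega), mul_comm (y s)])
    rw [interlacingSum_add_two b y s fun i hi => hb i (by omega), sub_mul, map_sub, mul_assoc, i1,
      mul_assoc, i0, ← map_sub, ← sub_eq_zero, ← map_sub, ← neg_eq_zero, ← map_neg, ← i2]
    congr 1
    rw [boundarySum_succ _ _ (s + 1), boundarySum_succ _ _ s, Finset.prod_range_succ _ (s + 1)]
    ring

end Weights

section Products

variable {R : Type*} [CommRing R] {n : ℕ}

/-- The Vandermonde product `∏_{i<j} (x_i - x_j)`, as a determinant. -/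
def vandermondeProd (x : Fin n → R) : R := (Matrix.vandermonde fun i => -x i).det

theorem vandermondeProd_eq_prod (x : Fin n → R) :
    vandermondeProd x = ∏ i, ∏ j, if i < j then x i - x j else 1 := by
  rw [vandermondeProd, Matrix.det_vandermonde]
  refine Finset.prod_congr rfl fun i _ => ?_
  rw [← Finset.prod_filter]
  refine Finset.prod_congr (by ext; simp) fun j _ => by ring

theorem vandermondeProd_succ (x : Fin (n + 1) → R) :
    vandermondeProd x =
      ∑ r : Fin (n + 1), (-1) ^ (r : ℕ) * x r ^ n * vandermondeProd (x ∘ r.succAbove) := by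
  rw [vandermondeProd, Matrix.det_succ_column _ (Fin.last n)]
  refine Finset.sum_congr rfl fun r _ => ?_
  have h : (Matrix.vandermonde fun i => -x i).submatrix r.succAbove (Fin.last n).succAbove =
      Matrix.vandermonde fun i => -(x ∘ r.succAbove) i := by
    ext i j
    simp [Matrix.vandermonde_apply]
  rw [h, vandermondeProd, Matrix.vandermonde_apply, Fin.val_last, neg_pow (x r), pow_add]
  have h2 : ((-1 : R) ^ n) * (-1) ^ n = 1 := by rw [← mul_pow]; simp
  linear_combination ((-1) ^ (r : ℕ) * x r ^ n *
    (Matrix.vandermonde fun i => -(x ∘ r.succAbove) i).det) * h2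

theorem vandermondeProd_comp_swap (x : Fin n → R) {i j : Fin n} (h : i ≠ j) :
    vandermondeProd (x ∘ Equiv.swap i j) = -vandermondeProd x := by
  have h1 : (Matrix.vandermonde fun a => -(x ∘ Equiv.swap i j) a) =
      (Matrix.vandermonde fun a => -x a).submatrix (Equiv.swap i j) id := by
    ext a c
    simp [Matrix.vandermonde_apply]
  rw [vandermondeProd, h1, Matrix.det_permute, Equiv.Perm.sign_swap h, vandermondeProd]
  simp

/-- The product `∏_{i<j} (1 + x_j + x_i x_j)`. -/
def shiftProd (x : Fin n → R) : R :=
  ∏ i, ∏ j, if i < j then 1 + x j + x i * x j else 1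

theorem shiftProd_of_eq_zero (x : Fin (n + 1) → R) (r : Fin (n + 1)) (hr : x r = 0) :
    shiftProd x = (∏ i : Fin n, if (r : ℕ) ≤ i then 1 + x (r.succAbove i) else 1) *
      shiftProd (x ∘ r.succAbove) := by
  have h (i : Fin n) : r < r.succAbove i ↔ (r : ℕ) ≤ i := by
    rw [Fin.lt_succAbove_iff_le_castSucc, Fin.le_def, Fin.val_castSucc]
  rw [shiftProd, Fin.prod_univ_succAbove _ r, Fin.prod_univ_succAbove _ r]
  simp only [lt_irrefl, if_false, one_mul, hr, zero_mul, add_zero, h, shiftProd]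
  congr 1
  refine Finset.prod_congr rfl fun i _ => ?_
  rw [Fin.prod_univ_succAbove _ r]
  simp only [hr, add_zero, mul_zero, ite_self, one_mul, Fin.succAbove_lt_succAbove_iff,
    Function.comp_apply]

/-- Multiplying `shiftProd x` by the factor of an adjacent inverted pair makes it invariant
under the corresponding exchange. -/
theorem shiftProd_mul_comp_swap (x : Fin n → R) {i j : Fin n} (h : (j : ℕ) = i + 1) :
    shiftProd (x ∘ Equiv.swap i j) * (1 + x j + x j * x i) =
      shiftProd x * (1 + x i + x j * x i) := by
  have key (z : Fin n → R) : shiftProd z * (1 + z i + z j * z i) =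
      ∏ p : Fin n × Fin n,
        if p.1 < p.2 ∨ p = (j, i) then 1 + z p.2 + z p.1 * z p.2 else 1 := by
    rw [shiftProd, ← Fintype.prod_prod_type', ← Finset.prod_filter, ← Finset.prod_filter,
      Finset.filter_or, Finset.prod_union]
    · simp [Finset.filter_eq']
    · rw [Finset.disjoint_left]
      intro p hp hq
      simp only [Finset.mem_filter, Finset.mem_univ, true_and] at hp hq
      subst hq
      simp only [Fin.lt_def] at hp
      omega
  have h2 := key (x ∘ Equiv.swap i j)
  simp only [Function.comp_apply, Equiv.swap_apply_left, Equiv.swap_apply_right] at h2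
  rw [key x, mul_comm (x j), h2,
    ← Equiv.prod_comp ((Equiv.swap i j).prodCongr (Equiv.swap i j))]
  refine Finset.prod_congr rfl fun p _ => ?_
  obtain ⟨a, c⟩ := p
  simp only [Equiv.prodCongr_apply, Prod.map_apply, Equiv.swap_apply_self]
  refine if_congr ?_ rfl rfl
  simp only [Equiv.swap_apply_def, Prod.mk.injEq, Fin.lt_def, Fin.ext_iff]
  split_ifs <;> omega

end Products

section Coefficients

open MvPolynomial

theorem coeff_eq_zero_of_rename_swap {n : ℕ} {i j : Fin n} (d : Fin n →₀ ℕ) (hd : d i = d j)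
    (f : MvPolynomial (Fin n) ℚ) (hf : rename (Equiv.swap i j) f = -f) : coeff d f = 0 := by
  have h1 : d.mapDomain (Equiv.swap i j) = d := by
    ext a
    rw [← Finsupp.equivMapDomain_eq_mapDomain, Finsupp.equivMapDomain_apply, Equiv.symm_swap,
      Equiv.swap_apply_def]
    split_ifs with h h' <;> simp_all
  have h2 := coeff_rename_mapDomain _ (Equiv.swap i j).injective f d
  rw [h1, hf, coeff_neg] at h2
  linarith

/-- Extracting the coefficient of a pure power of one variable times another monomial amounts to
setting that variable to zero. -/
theorem coeff_X_pow_mul_succAbove {n : ℕ} (r : Fin (n + 1)) (d : Fin (n + 1) →₀ ℕ)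
    (e : Fin n →₀ ℕ) (he : ∀ i, e i = d (r.succAbove i)) (f : MvPolynomial (Fin (n + 1)) ℚ) :
    coeff d (X r ^ d r * f) =
      coeff e (aeval (r.insertNth 0 X : Fin (n + 1) → MvPolynomial (Fin n) ℚ) f) := by
  induction f using MvPolynomial.induction_on' with
  | add p q hp hq => rw [mul_add, coeff_add, map_add, coeff_add, hp, hq]
  | monomial u a =>
    have h1 : aeval (r.insertNth 0 X : Fin (n + 1) → MvPolynomial (Fin n) ℚ) (monomial u a) =
        C a * (0 ^ u r * ∏ i, X i ^ u (r.succAbove i)) := by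
      rw [aeval_monomial, Finsupp.prod_fintype _ _ (by simp), Fin.prod_univ_succAbove _ r]
      simp [algebraMap_eq]
    have h2 : (∏ i, X i ^ u (r.succAbove i) : MvPolynomial (Fin n) ℚ) =
        monomial (Finsupp.equivFunOnFinite.symm fun i => u (r.succAbove i)) 1 := by
      rw [monomial_eq, Finsupp.prod_fintype _ _ (by simp)]
      simp
    rw [h1, h2, coeff_C_mul, X_pow_eq_monomial, monomial_mul, coeff_monomial, one_mul]
    rcases Nat.eq_zero_or_pos (u r) with h | h
    · rw [h, pow_zero, one_mul, coeff_monomial, mul_ite, mul_one, mul_zero]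
      refine if_congr ?_ rfl rfl
      constructor
      · intro hu
        ext i
        rw [he, ← hu]
        simp [Fin.succAbove_ne]
      · intro hu
        ext i
        rcases Fin.eq_self_or_eq_succAbove r i with rfl | ⟨i, rfl⟩
        · simp [h]
        · rw [← he, ← hu]
          simp [Fin.succAbove_ne]
    · rw [zero_pow h.ne', zero_mul, coeff_zero, mul_zero, if_neg]
      intro hu
      have := DFunLike.congr_fun hu r
      simp at this
      omega

/-- The exponents `n - 1` in positions `i < s` and `n + s - 1 - i` in positions `i ≥ s`. -/
noncomputable def truncDeg (n s : ℕ) : Fin n →₀ ℕ :=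
  Finsupp.equivFunOnFinite.symm fun i => if (i : ℕ) < s then n - 1 else n + s - (i + 1)

/-- The coefficient of `x ^ truncDeg n s` in
`∏_i (1 + x_i) ^ e_i ∏_{i<j} (x_i - x_j) (1 + x_j + x_i x_j)`. -/
noncomputable def truncCoeff (n s : ℕ) (e : ℕ → ℕ) : ℚ :=
  coeff (truncDeg n s)
    ((∏ i : Fin n, (1 + X i) ^ e i) * (vandermondeProd X * shiftProd X) :
      MvPolynomial (Fin n) ℚ)

/-- The exponents of `truncDeg (n + 1) s` with an entry in a position at most `s` removed. -/
noncomputable def midDeg (n s : ℕ) : Fin n →₀ ℕ :=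
  Finsupp.equivFunOnFinite.symm fun i => if (i : ℕ) < s then n else n + s - (i + 1)

theorem map_vandermondeProd {R S : Type*} [CommRing R] [CommRing S] {F : Type*} [FunLike F R S]
    [RingHomClass F R S] {n : ℕ} (φ : F) (x : Fin n → R) :
    φ (vandermondeProd x) = vandermondeProd (φ ∘ x) := by
  simp only [vandermondeProd_eq_prod, map_prod, apply_ite φ, map_sub, map_one, Function.comp_apply]

theorem map_shiftProd {R S : Type*} [CommRing R] [CommRing S] {F : Type*} [FunLike F R S]
    [RingHomClass F R S] {n : ℕ} (φ : F) (x : Fin n → R) :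
    φ (shiftProd x) = shiftProd (φ ∘ x) := by
  simp only [shiftProd, map_prod, apply_ite φ, map_add, map_mul, map_one, Function.comp_apply]

theorem truncCoeff_eq_boundary {n s : ℕ} (hs : s ≤ n) (e : ℕ → ℕ) :
    truncCoeff (n + 1) s e = ∑ r ∈ Finset.range (s + 1), (-1) ^ r *
      coeff (midDeg n s) ((∏ i : Fin n, (1 + X i) ^ (if (i : ℕ) < r then e i else e (i + 1) + 1)) *
        (vandermondeProd X * shiftProd X) : MvPolynomial (Fin n) ℚ) := by
  have term (r : Fin (n + 1)) : coeff (truncDeg (n + 1) s)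
      ((∏ i : Fin (n + 1), (1 + X i) ^ e i) * ((-1) ^ (r : ℕ) * X r ^ n *
        vandermondeProd (X ∘ r.succAbove) * shiftProd X) : MvPolynomial (Fin (n + 1)) ℚ) =
      if (r : ℕ) < s + 1 then (-1) ^ (r : ℕ) * coeff (midDeg n s)
        ((∏ i : Fin n, (1 + X i) ^ (if (i : ℕ) < r then e i else e (i + 1) + 1)) *
        (vandermondeProd X * shiftProd X) : MvPolynomial (Fin n) ℚ) else 0 := by
    have h0 : ((∏ i : Fin (n + 1), (1 + X i) ^ e i) * ((-1) ^ (r : ℕ) * X r ^ n *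
        vandermondeProd (X ∘ r.succAbove) * shiftProd X) : MvPolynomial (Fin (n + 1)) ℚ) =
        C ((-1) ^ (r : ℕ)) * (X r ^ n * ((∏ i : Fin (n + 1), (1 + X i) ^ e i) *
          (vandermondeProd (X ∘ r.succAbove) * shiftProd X))) := by
      simp only [map_pow, map_neg, map_one]
      ring
    rw [h0, coeff_C_mul]
    split_ifs with hr
    · have hd : truncDeg (n + 1) s r = n := by
        simp only [truncDeg, Finsupp.equivFunOnFinite_symm_apply_apply]
        split_ifs <;> omega
      have hm := coeff_X_pow_mul_succAbove r (truncDeg (n + 1) s) (midDeg n s) (fun i => by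
        simp only [truncDeg, midDeg, Finsupp.equivFunOnFinite_symm_apply_apply, Fin.succAbove,
          Fin.lt_def, Fin.val_castSucc]
        split_ifs <;> simp only [Fin.val_castSucc, Fin.val_succ] at * <;> omega)
        ((∏ i : Fin (n + 1), (1 + X i) ^ e i) *
          (vandermondeProd (X ∘ r.succAbove) * shiftProd X))
      rw [hd] at hm
      rw [hm]
      have hX : (aeval (r.insertNth 0 X : Fin (n + 1) → MvPolynomial (Fin n) ℚ) ∘
          (X : Fin (n + 1) → MvPolynomial (Fin (n + 1)) ℚ)) =
          (r.insertNth 0 X : Fin (n + 1) → MvPolynomial (Fin n) ℚ) := by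
        funext i
        simp
      have hX' : (r.insertNth 0 X : Fin (n + 1) → MvPolynomial (Fin n) ℚ) ∘ r.succAbove = X := by
        funext i
        simp
      have hp : aeval (r.insertNth 0 X : Fin (n + 1) → MvPolynomial (Fin n) ℚ)
          (∏ i : Fin (n + 1), (1 + X i) ^ e i : MvPolynomial (Fin (n + 1)) ℚ) *
          (∏ i : Fin n, if (r : ℕ) ≤ i then
            1 + (r.insertNth 0 X : Fin (n + 1) → MvPolynomial (Fin n) ℚ) (r.succAbove i) else 1) =
          ∏ i : Fin n, (1 + X i) ^ (if (i : ℕ) < r then e i else e (i + 1) + 1) := by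
        rw [Fin.prod_univ_succAbove _ r]
        simp only [map_mul, map_prod, map_pow, map_add, map_one, aeval_X, Fin.insertNth_apply_same,
          Fin.insertNth_apply_succAbove, add_zero, one_pow, one_mul]
        rw [← Finset.prod_mul_distrib]
        refine Finset.prod_congr rfl fun i _ => ?_
        by_cases hi : (i : ℕ) < r
        · rw [Fin.succAbove_of_castSucc_lt _ _ hi, if_neg (by omega), if_pos hi, mul_one,
            Fin.val_castSucc]
        · rw [Fin.succAbove_of_le_castSucc _ _ (by simpa [Fin.le_def] using hi),
            if_pos (by omega), if_neg hi, pow_succ, Fin.val_succ]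
      rw [map_mul, map_mul, map_vandermondeProd, map_shiftProd, ← Function.comp_assoc, hX, hX',
        shiftProd_of_eq_zero _ r (by simp), hX', ← hp]
      ring_nf
    · rw [X_pow_eq_monomial, coeff_monomial_mul', if_neg, mul_zero]
      rw [Finsupp.single_le_iff]
      simp only [truncDeg, Finsupp.equivFunOnFinite_symm_apply_apply]
      split_ifs <;> omega
  rw [truncCoeff, vandermondeProd_succ, Finset.sum_mul, Finset.mul_sum, coeff_sum,
    Finset.sum_congr rfl fun r _ => term r, Fin.sum_univ_eq_sum_range (fun r =>
      if (r : ℕ) < s + 1 then (-1) ^ (r : ℕ) * coeff (midDeg n s)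
        ((∏ i : Fin n, (1 + X i) ^ (if (i : ℕ) < r then e i else e (i + 1) + 1)) *
        (vandermondeProd X * shiftProd X) : MvPolynomial (Fin n) ℚ) else 0),
    ← Finset.sum_filter]
  refine Finset.sum_congr ?_ fun _ _ => rfl
  ext r
  simp
  omega

end Coefficients

section Recursion

open MvPolynomial

theorem coeff_mul_shiftProd_eq_zero {n : ℕ} {i j : Fin n} (hij : (j : ℕ) = i + 1) (d : Fin n →₀ ℕ)
    (hd : d i = d j) (f : MvPolynomial (Fin n) ℚ) (hf : rename (Equiv.swap i j) f = f) :
    coeff d (f * (1 + X i + X j * X i) * (vandermondeProd X * shiftProd X)) = 0 := by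
  refine coeff_eq_zero_of_rename_swap (i := i) (j := j) d hd _ ?_
  have hX : (rename (Equiv.swap i j) ∘ X : Fin n → MvPolynomial (Fin n) ℚ) =
      X ∘ Equiv.swap i j := by
    funext a
    simp
  have h := shiftProd_mul_comp_swap (X : Fin n → MvPolynomial (Fin n) ℚ) hij
  simp only [map_mul, map_add, map_one, rename_X, Equiv.swap_apply_left, Equiv.swap_apply_right,
    map_vandermondeProd, map_shiftProd, hf]
  rw [hX, vandermondeProd_comp_swap _ (by rintro rfl; omega)]
  linear_combination (-f * vandermondeProd X) * h

/-- Summing over interlacing sequences turns the coefficient for `n` variables into the one for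
`n + 1` variables. -/
theorem truncCoeff_succ {n s : ℕ} (hs : s ≤ n) (e : ℕ → ℕ) (he : ∀ i < s, e i < e (i + 1)) :
    truncCoeff (n + 1) s e = ∑ l ∈ interlacing e s,
      truncCoeff n s (fun i => if i < s then l i else e (i + 1) + 1) := by
  set x : ℕ → MvPolynomial (Fin n) ℚ := fun i => if h : i < n then X ⟨i, h⟩ else 0 with hx
  have hxX (i : Fin n) : x i = X i := by simp [hx]
  set y : ℕ → MvPolynomial (Fin n) ℚ := fun i => 1 + x i with hy
  let Λ : MvPolynomial (Fin n) ℚ →+ ℚ :=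
    { toFun := fun f => coeff (midDeg n s) (f * (vandermondeProd X * shiftProd X))
      map_zero' := by simp
      map_add' := fun f g => by rw [add_mul, coeff_add] }
  have hΛ (f) : Λ f = coeff (midDeg n s) (f * (vandermondeProd X * shiftProd X)) := rfl
  let τ : ℕ → MvPolynomial (Fin n) ℚ →+* MvPolynomial (Fin n) ℚ := fun i =>
    if h : i + 1 < n then (rename (Equiv.swap (⟨i, by omega⟩ : Fin n) ⟨i + 1, h⟩)).toRingHom
    else RingHom.id _
  have hτ (i : ℕ) (h : i + 1 < n) (f) :
      τ i f = rename (Equiv.swap (⟨i, by omega⟩ : Fin n) ⟨i + 1, h⟩) f := by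
    simp [τ, h]
  have hτX (i : ℕ) (h : i + 1 < n) (a : Fin n) :
      τ i (y a) = y (Equiv.swap (⟨i, by omega⟩ : Fin n) ⟨i + 1, h⟩ a : Fin n) := by
    simp only [hy, hxX, hτ i h, map_add, map_one, rename_X]
  have hfix (i : ℕ) (h : i + 1 < n) (j : ℕ) (hj : j < n) (h1 : j ≠ i) (h2 : j ≠ i + 1) :
      τ i (y j) = y j := by
    rw [hτX i h ⟨j, hj⟩, Equiv.swap_apply_of_ne_of_ne] <;> simp [Fin.ext_iff, h1, h2]
  set g : MvPolynomial (Fin n) ℚ := ∏ i ∈ Finset.Ico s n, y i ^ (e (i + 1) + 1) with hg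
  have main := map_interlacingSum_mul Λ e y τ s he
    (fun i hi => by simpa using hτX i (by omega) ⟨i, by omega⟩)
    (fun i hi => by simpa using hτX i (by omega) ⟨i + 1, by omega⟩)
    (fun i hi j hj => hfix i (by omega) j (by omega))
    (fun i hi f hf => by
      rw [hτ i (by omega)] at hf
      have := coeff_mul_shiftProd_eq_zero rfl (midDeg n s)
        (by simp [midDeg, hi, show i < s by omega]) f hf
      rw [hΛ, ← this]
      congr 3
      simp only [hy, hx, dif_pos (show i < n by omega), dif_pos (show i + 1 < n by omega)]
      ring) g
    (fun i hi => by
      simp only [hg, map_prod, map_pow]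
      refine Finset.prod_congr rfl fun j hj => ?_
      rw [Finset.mem_Ico] at hj
      rw [hfix i (by omega) j (by omega) (by omega) (by omega)])
  have split (w : ℕ → ℕ) (r : ℕ) (hr : r ≤ n) : (∏ i : Fin n, (1 + X i) ^ w i :
      MvPolynomial (Fin n) ℚ) = (∏ i ∈ Finset.range r, y i ^ w i) *
        ∏ i ∈ Finset.Ico r n, y i ^ w i := by
    rw [Finset.prod_range_mul_prod_Ico _ hr, ← Fin.prod_univ_eq_prod_range (fun i => y i ^ w i)]
    simp only [hy, hxX]
  have left : truncCoeff (n + 1) s e = Λ (boundarySum e y s * g) := by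
    rw [truncCoeff_eq_boundary hs, boundarySum, Finset.sum_mul, map_sum]
    refine Finset.sum_congr rfl fun r hr => ?_
    rw [Finset.mem_range] at hr
    rw [split (fun i => if i < r then e i else e (i + 1) + 1) r (by omega), hΛ, ← coeff_C_mul]
    congr 1
    rw [← Finset.prod_Ico_consecutive _ (show r ≤ s by omega) hs, hg]
    rw [Finset.prod_congr rfl (g := fun i => y i ^ e i), Finset.prod_congr rfl
      (s₁ := Finset.Ico r s) (g := fun i => y i ^ (e (i + 1) + 1)), Finset.prod_congr rfl
      (s₁ := Finset.Ico s n) (g := fun i => y i ^ (e (i + 1) + 1))]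
    · simp only [map_pow, map_neg, map_one]
      simp only [mul_assoc]
    · intro i hi
      rw [Finset.mem_Ico] at hi
      rw [if_neg (by omega)]
    · intro i hi
      rw [Finset.mem_Ico] at hi
      rw [if_neg (by omega)]
    · intro i hi
      rw [Finset.mem_range] at hi
      rw [if_pos hi]
  rw [left, ← main, interlacingSum, Finset.sum_mul, map_sum]
  refine Finset.sum_congr rfl fun l _ => ?_
  rw [truncCoeff, split (fun i => if i < s then l i else e (i + 1) + 1) s hs, hΛ]
  let δ : Fin n →₀ ℕ := Finsupp.equivFunOnFinite.symm fun i => if (i : ℕ) < s then 1 else 0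
  have hδ : midDeg n s = δ + truncDeg n s := by
    ext i
    simp only [midDeg, truncDeg, δ, Finsupp.add_apply, Finsupp.equivFunOnFinite_symm_apply_apply]
    have := i.2
    split_ifs <;> omega
  have hδX : ∏ i ∈ Finset.range s, (y i - 1) = monomial δ (1 : ℚ) := by
    rw [monomial_eq, Finsupp.prod_fintype _ _ (by simp)]
    simp only [δ, Finsupp.equivFunOnFinite_symm_apply_apply, map_one, one_mul, ← hxX]
    rw [Fin.prod_univ_eq_prod_range (fun i => x i ^ (if i < s then 1 else 0)),
      ← Finset.prod_range_mul_prod_Ico _ hs]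
    have h1 : ∏ i ∈ Finset.range s, x i ^ (if i < s then 1 else 0) = ∏ i ∈ Finset.range s, x i :=
      Finset.prod_congr rfl fun i hi => by rw [if_pos (Finset.mem_range.mp hi), pow_one]
    have h2 : ∏ i ∈ Finset.Ico s n, x i ^ (if i < s then 1 else 0) = 1 :=
      Finset.prod_eq_one fun i hi => by
        rw [if_neg (not_lt.mpr (Finset.mem_Ico.mp hi).1), pow_zero]
    rw [h1, h2, mul_one]
    simp [hy]
  rw [Finset.prod_mul_distrib, hδX, hδ, mul_comm _ (monomial δ 1), mul_assoc, mul_assoc,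
    coeff_monomial_mul, one_mul, ← mul_assoc]
  congr 2
  congr 1
  · refine Finset.prod_congr rfl fun i hi => ?_
    rw [Finset.mem_range] at hi
    rw [if_pos hi]
  · refine Finset.prod_congr rfl fun i hi => ?_
    rw [Finset.mem_Ico] at hi
    rw [if_neg (by omega)]

end Recursion

section Trapezoids

theorem truncCoeff_min_succ (n k : ℕ) (e : ℕ → ℕ) :
    truncCoeff (n + 1) (min (n + 1) k) e = truncCoeff (n + 1) (min n k) e := by
  have : truncDeg (n + 1) (min (n + 1) k) = truncDeg (n + 1) (min n k) := by
    ext i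
    simp only [truncDeg, Finsupp.equivFunOnFinite_symm_apply_apply]
    have := i.2
    split_ifs <;> omega
  rw [truncCoeff, this, truncCoeff]

theorem isGog_update {m n k : ℕ} {e l : ℕ → ℕ} {a : ℕ → ℕ → ℤ}
    (h_pos : ∀ j < min (n + 1) k, 1 ≤ e j)
    (h_lt : ∀ j, j + 1 < min (n + 1) k → e j < e (j + 1))
    (h_le : ∀ j < min (n + 1) k, e j ≤ m + min (n + 1) k)
    (hl : ∀ j < min n k, e j ≤ l j ∧ l j ≤ e (j + 1)) (ha : IsGog (m + 1) n k a)
    (hal : ∀ j < min n k, a n (j + 1) = l j) :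
    IsGog m (n + 1) k (Function.update a (n + 1)
      fun j => if 1 ≤ j ∧ j ≤ min (n + 1) k then (e (j - 1) : ℤ) else 0) := by
  have bound : ∀ t j, j + t + 1 = min (n + 1) k → e j ≤ m + j + 1 := by
    intro t
    induction t with
    | zero =>
      intro j hj
      have := h_le j (by omega)
      omega
    | succ t ih =>
      intro j hj
      have := ih (j + 1) (by omega)
      have := h_lt j (by omega)
      omega
  obtain ⟨h1, h2, h3, h4, h5⟩ := ha
  refine ⟨fun i j hp => ?_, fun i j hp hq => ?_, fun i j hp hq => ?_, fun i j hp hq => ?_,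
    fun i j hp => ?_⟩
  · rcases eq_or_ne i (n + 1) with rfl | hi
    · simp only [GogPos] at hp
      obtain ⟨j, rfl⟩ := Nat.exists_eq_add_of_le' hp.2.2.1
      have := bound (min (n + 1) k - (j + 1)) j (by omega)
      have := h_pos j (by omega)
      rw [Function.update_self, if_pos (by omega), Nat.add_sub_cancel]
      omega
    · rw [Function.update_of_ne hi]
      have := h1 i j (by simp only [GogPos] at *; omega)
      simp only [GogPos] at hp
      omega
  · have hi : i ≠ n + 1 := by simp only [GogPos] at hq; omega
    rw [Function.update_of_ne hi]
    rcases eq_or_ne i n with rfl | hi'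
    · simp only [GogPos] at hp
      obtain ⟨j, rfl⟩ := Nat.exists_eq_add_of_le' hp.2.2.1
      rw [Function.update_self, if_pos (by omega), hal j (by omega), Nat.add_sub_cancel]
      exact_mod_cast (hl j (by omega)).1
    · rw [Function.update_of_ne (by omega)]
      exact h2 i j (by simp only [GogPos] at *; omega) (by simp only [GogPos] at *; omega)
  · have hi : i ≠ n + 1 := by simp only [GogPos] at hq; omega
    rw [Function.update_of_ne hi]
    rcases eq_or_ne i n with rfl | hi'
    · simp only [GogPos] at hp hq
      obtain ⟨j, rfl⟩ := Nat.exists_eq_add_of_le' hp.2.2.1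
      rw [Function.update_self, if_pos (by omega), hal j (by omega), Nat.add_sub_cancel]
      exact_mod_cast (hl j (by omega)).2
    · rw [Function.update_of_ne (by omega)]
      exact h3 i j (by simp only [GogPos] at *; omega) (by simp only [GogPos] at *; omega)
  · rcases eq_or_ne i (n + 1) with rfl | hi
    · simp only [GogPos] at hp hq
      obtain ⟨j, rfl⟩ := Nat.exists_eq_add_of_le' hp.2.2.1
      simp only [Function.update_self]
      rw [if_pos (by omega), if_pos (by omega), Nat.add_sub_cancel, Nat.add_sub_cancel]
      exact_mod_cast h_lt j (by omega)
    · rw [Function.update_of_ne hi]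
      exact h4 i j (by simp only [GogPos] at *; omega) (by simp only [GogPos] at *; omega)
  · rcases eq_or_ne i (n + 1) with rfl | hi
    · simp only [GogPos] at hp
      rw [Function.update_self, if_neg (by omega)]
    · rw [Function.update_of_ne hi]
      exact h5 i j (by simp only [GogPos] at *; omega)

theorem IsGog.update_zero {m n k : ℕ} {a : ℕ → ℕ → ℤ} (ha : IsGog m (n + 1) k a) :
    IsGog (m + 1) n k (Function.update a (n + 1) 0) := by
  obtain ⟨h1, h2, h3, h4, h5⟩ := ha
  refine ⟨fun i j hp => ?_, fun i j hp hq => ?_, fun i j hp hq => ?_, fun i j hp hq => ?_,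
    fun i j hp => ?_⟩
  · have hi : i ≠ n + 1 := by simp only [GogPos] at hp; omega
    rw [Function.update_of_ne hi]
    have := h1 i j (by simp only [GogPos] at *; omega)
    simp only [GogPos] at hp
    omega
  · simp only [GogPos] at hp hq
    rw [Function.update_of_ne (by omega), Function.update_of_ne (by omega)]
    exact h2 i j (by simp only [GogPos]; omega) (by simp only [GogPos]; omega)
  · simp only [GogPos] at hp hq
    rw [Function.update_of_ne (by omega), Function.update_of_ne (by omega)]
    exact h3 i j (by simp only [GogPos]; omega) (by simp only [GogPos]; omega)
  · simp only [GogPos] at hp hq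
    rw [Function.update_of_ne (by omega)]
    exact h4 i j (by simp only [GogPos]; omega) (by simp only [GogPos]; omega)
  · rcases eq_or_ne i (n + 1) with rfl | hi
    · simp
    · rw [Function.update_of_ne hi]
      exact h5 i j (by simp only [GogPos] at *; omega)

theorem IsGog.interlacing_row {m n k : ℕ} {e : ℕ → ℕ} {a : ℕ → ℕ → ℤ}
    (ha : IsGog m (n + 1) k a) (hb : ∀ j < min (n + 1) k, a (n + 1) (j + 1) = e j)
    (h_top : k ≤ n → e k = m + k + 1) :
    (fun j => if j < min n k then (a n (j + 1)).toNat else 0) ∈ interlacing e (min n k) := by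
  obtain ⟨h1, h2, h3, h4, h5⟩ := ha
  rw [mem_interlacing]
  refine ⟨fun i hi => ?_, fun i hi => ?_, fun i hi => ?_⟩
  · have l1 := h1 n (i + 1) (by simp only [GogPos]; omega)
    have l2 := h2 n (i + 1) (by simp only [GogPos]; omega) (by simp only [GogPos]; omega)
    rw [hb i (by omega)] at l2
    simp only [hi, if_true]
    refine ⟨by omega, ?_⟩
    by_cases h : i + 1 < min (n + 1) k
    · have l3 := h3 n (i + 1) (by simp only [GogPos]; omega) (by simp only [GogPos]; omega)
      rw [hb (i + 1) h] at l3
      omega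
    · have hk : i + 1 = k := by omega
      subst hk
      have := h_top (by omega)
      omega
  · have l1 := h1 n (i + 1) (by simp only [GogPos]; omega)
    have l4 := h4 n (i + 1) (by simp only [GogPos]; omega) (by simp only [GogPos]; omega)
    simp only [hi, show i < min n k by omega, if_true]
    omega
  · rw [if_neg (by omega)]

/-- The trapezoids with bottom row `e` in row `n`, for any number `k` of columns, form a finite
set counted by `truncCoeff`. -/
theorem exists_finset_gog (n k : ℕ) : ∀ (m : ℕ) (e : ℕ → ℕ),
    (∀ j < min n k, 1 ≤ e j) → (∀ j, j + 1 < min n k → e j < e (j + 1)) →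
    (∀ j < min n k, e j ≤ m + min n k) → (∀ j, min n k ≤ j → j < n → e j = m + min n k + 1) →
    ∃ G : Finset (ℕ → ℕ → ℤ),
      (∀ a, a ∈ G ↔ IsGog m n k a ∧ ∀ j < min n k, a n (j + 1) = e j) ∧
      (G.card : ℚ) = truncCoeff n (min n k) e := by
  classical
  induction n with
  | zero =>
    intro m e _ _ _ _
    refine ⟨{0}, fun a => ?_, ?_⟩
    · have h (i j : ℕ) : ¬ GogPos 0 k i j := by simp only [GogPos]; omega
      simp only [IsGog, h, Finset.mem_singleton, funext_iff]
      simp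
    · have : truncDeg 0 0 = 0 := Subsingleton.elim _ _
      simp [truncCoeff, this, vandermondeProd, shiftProd]
  | succ n ih =>
    intro m e h_pos h_lt h_le h_top
    set s := min n k with hs
    have he : ∀ i < s, e i < e (i + 1) := by
      intro i hi
      by_cases h : i + 1 < min (n + 1) k
      · exact h_lt i h
      · have := h_le i (by omega)
        have := h_top (i + 1) (by omega) (by omega)
        omega
    have he_mono : ∀ i ≤ s, e i ≤ m + 1 + s := by
      intro i hi
      by_cases h : i < min (n + 1) k
      · have := h_le i h
        omega
      · have := h_top i (by omega) (by omega)
        omega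
    have hG : ∀ l : ℕ → ℕ, ∃ G : Finset (ℕ → ℕ → ℤ), l ∈ interlacing e s →
        (∀ a, a ∈ G ↔ IsGog (m + 1) n k a ∧ ∀ j < s, a n (j + 1) = l j) ∧
        (G.card : ℚ) = truncCoeff n s (fun i => if i < s then l i else e (i + 1) + 1) := by
      intro l
      by_cases hl : l ∈ interlacing e s
      · obtain ⟨h1, h2, h3⟩ := mem_interlacing.mp hl
        obtain ⟨G, hG1, hG2⟩ := ih (m + 1) (fun i => if i < s then l i else e (i + 1) + 1)
          (fun j hj => by
            have := h1 j hj
            have := h_pos j (by omega)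
            simp only [hj, if_true]; omega)
          (fun j hj => by
            simpa only [hj, show j < s by omega, if_true] using h2 j hj)
          (fun j hj => by
            have := h1 j hj
            have := he_mono (j + 1) (by omega)
            simp only [hj, if_true]; omega)
          (fun j hj hjn => by
            have := h_top (j + 1) (by omega) (by omega)
            rw [if_neg (by omega)]
            omega)
        refine ⟨G, fun _ => ⟨fun a => ?_, hG2⟩⟩
        rw [hG1]
        refine and_congr_right fun _ => forall₂_congr fun j hj => ?_
        rw [if_pos hj]
      · exact ⟨∅, fun h => absurd h hl⟩
    choose G hG using hG
    set row : ℕ → ℤ := fun j => if 1 ≤ j ∧ j ≤ min (n + 1) k then (e (j - 1) : ℤ) else 0 with hrow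
    refine ⟨(interlacing e s).biUnion fun l =>
      (G l).image fun a => Function.update a (n + 1) row, fun a => ?_, ?_⟩
    · simp only [Finset.mem_biUnion, Finset.mem_image]
      constructor
      · rintro ⟨l, hl, a, ha, rfl⟩
        rw [(hG l hl).1] at ha
        rw [mem_interlacing] at hl
        refine ⟨isGog_update h_pos h_lt h_le hl.1 ha.1 ha.2, fun j hj => ?_⟩
        rw [Function.update_self, hrow]
        simp only [Nat.add_sub_cancel]
        rw [if_pos (by omega)]
      · rintro ⟨ha, hb⟩
        have hl := ha.interlacing_row hb fun hk => by
          have := h_top k (by omega) (by omega)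
          omega
        refine ⟨_, hl, Function.update a (n + 1) 0, ?_, ?_⟩
        · rw [(hG _ hl).1]
          refine ⟨ha.update_zero, fun j hj => ?_⟩
          have := ha.1 n (j + 1) (by simp only [GogPos]; omega)
          rw [Function.update_of_ne (by omega), if_pos hj]
          omega
        · rw [Function.update_idem, Function.update_eq_self_iff]
          funext j
          simp only [hrow]
          split_ifs with hj
          · have := hb (j - 1) (by omega)
            rw [Nat.sub_add_cancel hj.1] at this
            exact this.symm
          · exact (ha.2.2.2.2 _ _ (by simp only [GogPos]; omega)).symm
    · rw [Finset.card_biUnion, Nat.cast_sum, truncCoeff_min_succ, truncCoeff_succ (by omega) e he]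
      · refine Finset.sum_congr rfl fun l hl => ?_
        rw [← (hG l hl).2, Finset.card_image_of_injOn]
        intro a ha a' ha' h
        rw [Finset.mem_coe, (hG l hl).1] at ha ha'
        funext i
        rcases eq_or_ne i (n + 1) with rfl | hi
        · funext j
          have h (j : ℕ) : ¬ GogPos n k (n + 1) j := by simp only [GogPos]; omega
          rw [ha.1.2.2.2.2 _ _ (h j), ha'.1.2.2.2.2 _ _ (h j)]
        · simpa [hi] using congrFun h i
      · intro l hl l' hl' hne
        rw [Function.onFun, Finset.disjoint_left]
        intro a ha ha'
        simp only [Finset.mem_image] at ha ha'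
        obtain ⟨a, ha, rfl⟩ := ha
        obtain ⟨a', ha', h⟩ := ha'
        rw [(hG _ hl).1] at ha
        rw [(hG _ hl').1] at ha'
        rw [Finset.mem_coe, mem_interlacing] at hl hl'
        refine hne (funext fun j => ?_)
        by_cases hj : j < s
        · have h1 := congrFun (congrFun h n) (j + 1)
          rw [Function.update_of_ne (by omega), Function.update_of_ne (by omega), ha.2 j hj,
            ha'.2 j hj] at h1
          exact_mod_cast h1.symm
        · rw [hl.2.2 j (by omega), hl'.2.2 j (by omega)]

theorem prod_Icc_one_eq_prod_fin {M : Type*} [CommMonoid M] (n : ℕ) (f : ℕ → M) :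
    ∏ i ∈ Finset.Icc 1 n, f i = ∏ i : Fin n, f (i + 1) := by
  induction n with
  | zero => simp
  | succ n ih =>
    rw [Finset.prod_Icc_succ_top (by omega), ih, Fin.prod_univ_castSucc]
    rfl

end Trapezoids

section Transfer

open MvPolynomial

theorem gogDeg_eq_mapDomain {n k : ℕ} (hkn : k ≤ n) :
    gogDeg n k = (truncDeg n k).mapDomain (fun i : Fin n => (i : ℕ) + 1) := by
  have hinj : Function.Injective (fun i : Fin n => (i : ℕ) + 1) := fun i j h => by
    simpa [Fin.ext_iff] using h
  ext j
  simp only [gogDeg, Finsupp.add_apply, Finsupp.finsetSum_apply, Finsupp.single_apply,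
    Finset.sum_ite_eq', Finset.mem_Icc]
  by_cases hj : 1 ≤ j ∧ j ≤ n
  · have h : j = (fun i : Fin n => (i : ℕ) + 1) ⟨j - 1, by omega⟩ := by simp; omega
    conv_rhs => rw [h, Finsupp.mapDomain_apply hinj]
    simp only [truncDeg, Finsupp.equivFunOnFinite_symm_apply_apply]
    split_ifs <;> omega
  · rw [if_neg (by omega), if_neg (by omega), Finsupp.mapDomain_of_notMem_range, add_zero]
    rintro ⟨i, rfl⟩
    exact hj ⟨Nat.le_add_left 1 i, i.2⟩

theorem prod_filter_lt_eq {n : ℕ} {R : Type*} [CommRing R] (x : ℕ → R) :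
    ∏ p ∈ (Finset.Icc 1 n ×ˢ Finset.Icc 1 n).filter (fun p => p.1 < p.2),
      ((x p.1 - x p.2) * (1 + x p.2 + x p.1 * x p.2)) =
    vandermondeProd (fun i : Fin n => x (i + 1)) * shiftProd (fun i : Fin n => x (i + 1)) := by
  rw [Finset.prod_filter, Finset.prod_product, prod_Icc_one_eq_prod_fin, vandermondeProd_eq_prod,
    shiftProd, ← Finset.prod_mul_distrib]
  refine Finset.prod_congr rfl fun i _ => ?_
  rw [prod_Icc_one_eq_prod_fin, ← Finset.prod_mul_distrib]
  refine Finset.prod_congr rfl fun j _ => ?_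
  simp only [add_lt_add_iff_right, Fin.val_fin_lt]
  split_ifs <;> simp

end Transfer

/-- The number of `(m,n,k)`-Gog trapezoids with bottom row `(b_1,…,b_k)` is the constant term of
`∏_{i=1}^k (1+x_i)^{b_i} x_i^{−n+1} ∏_{i=k+1}^n (1+x_i)^{m+k+1} x_i^{−n+i−k}
 ∏_{1≤i<j≤n} (x_i−x_j)(1+x_j+x_i x_j)`. -/
theorem stmt5 (m n k : ℕ) (hk : 1 ≤ k) (hkn : k ≤ n) (b : ℕ → ℤ)
    (hb1 : 1 ≤ b 1) (hbk : b k ≤ (m : ℤ) + k)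
    (hbs : ∀ i, 1 ≤ i → i < k → b i < b (i+1)) :
    (Set.ncard {a : ℕ → ℕ → ℤ | IsGog m n k a ∧ ∀ j ∈ Finset.Icc 1 k, a n j = b j} : ℚ) =
    MvPolynomial.coeff (gogDeg n k)
      ((∏ i ∈ Finset.Icc 1 k, (1 + MvPolynomial.X i) ^ (b i).toNat) *
        (∏ i ∈ Finset.Icc (k+1) n, (1 + MvPolynomial.X i) ^ (m + k + 1)) *
        ∏ p ∈ (Finset.Icc 1 n ×ˢ Finset.Icc 1 n).filter (fun p => p.1 < p.2),
          ((MvPolynomial.X p.1 - MvPolynomial.X p.2) *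
            (1 + MvPolynomial.X p.2 + MvPolynomial.X p.1 * MvPolynomial.X p.2) :
            MvPolynomial ℕ ℚ)) := by
  set e : ℕ → ℕ := fun i => if i < k then (b (i + 1)).toNat else m + k + 1 with he
  have hs : min n k = k := min_eq_right hkn
  have pos : ∀ j < k, 1 ≤ b (j + 1) := by
    intro j
    induction j with
    | zero => exact fun _ => hb1
    | succ j ih =>
      intro hj
      have := ih (by omega)
      have := hbs (j + 1) (by omega) hj
      omega
  have le : ∀ t j, j + t + 1 = k → b (j + 1) ≤ m + k := by
    intro t
    induction t with
    | zero => rintro j rfl; exact hbk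
    | succ t ih =>
      intro j hj
      have := ih (j + 1) (by omega)
      have := hbs (j + 1) (by omega) (by omega)
      omega
  obtain ⟨G, hG, hcard⟩ := exists_finset_gog n k m e
    (fun j hj => by
      have := pos j (by omega)
      simp only [he]
      rw [if_pos (by omega)]
      omega)
    (fun j hj => by
      have := pos j (by omega)
      have := hbs (j + 1) (by omega) (by omega)
      simp only [he]
      rw [if_pos (by omega), if_pos (by omega)]
      omega)
    (fun j hj => by
      have := le (k - j - 1) j (by omega)
      simp only [he]
      rw [if_pos (by omega)]
      omega)
    (fun j hj _ => by
      simp only [he]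
      rw [if_neg (by omega), hs])
  have hset : {a : ℕ → ℕ → ℤ | IsGog m n k a ∧ ∀ j ∈ Finset.Icc 1 k, a n j = b j} = ↑G := by
    ext a
    simp only [Finset.mem_coe, hG, hs]
    refine and_congr_right fun _ => ⟨fun h j hj => ?_, fun h j hj => ?_⟩
    · have := pos j hj
      rw [h (j + 1) (by simp; omega)]
      simp only [he]
      rw [if_pos hj]
      omega
    · rw [Finset.mem_Icc] at hj
      obtain ⟨j, rfl⟩ := Nat.exists_eq_add_of_le' hj.1
      have := pos j (by omega)
      rw [h j (by omega)]
      simp only [he]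
      rw [if_pos (by omega)]
      omega
  rw [hset, Set.ncard_coe_finset, hcard, hs, truncCoeff, gogDeg_eq_mapDomain hkn,
    prod_filter_lt_eq]
  have hinj : Function.Injective (fun i : Fin n => (i : ℕ) + 1) := fun i j h => by
    simpa [Fin.ext_iff] using h
  rw [← MvPolynomial.coeff_rename_mapDomain _ hinj]
  have hX : (MvPolynomial.rename (fun i : Fin n => (i : ℕ) + 1) ∘ MvPolynomial.X :
      Fin n → MvPolynomial ℕ ℚ) = fun i : Fin n => MvPolynomial.X ((i : ℕ) + 1) := by
    funext i
    simp
  rw [map_mul, map_mul, map_vandermondeProd, map_shiftProd, hX]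
  congr 2
  have h1 : ∏ i ∈ Finset.Icc 1 k, ((1 + MvPolynomial.X i) ^ (b i).toNat : MvPolynomial ℕ ℚ) =
      ∏ i ∈ Finset.Icc 1 k, (1 + MvPolynomial.X i) ^ e (i - 1) := by
    refine Finset.prod_congr rfl fun i hi => ?_
    rw [Finset.mem_Icc] at hi
    simp only [he]
    rw [if_pos (by omega), Nat.sub_add_cancel hi.1]
  have h2 : ∏ i ∈ Finset.Icc (k + 1) n, ((1 + MvPolynomial.X i) ^ (m + k + 1) :
      MvPolynomial ℕ ℚ) = ∏ i ∈ Finset.Icc (k + 1) n, (1 + MvPolynomial.X i) ^ e (i - 1) := by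
    refine Finset.prod_congr rfl fun i hi => ?_
    rw [Finset.mem_Icc] at hi
    simp only [he]
    rw [if_neg (by omega)]
  have h3 : Finset.Icc 1 n = Finset.Icc 1 k ∪ Finset.Icc (k + 1) n := by
    ext i
    simp only [Finset.mem_union, Finset.mem_Icc]
    omega
  rw [h1, h2, ← Finset.prod_union, ← h3, prod_Icc_one_eq_prod_fin]
  · simp
  · rw [Finset.disjoint_left]
    intro i hi hi'
    rw [Finset.mem_Icc] at hi hi'
    omega
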